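/- The automorphism ψ_c^+ acts on Ω_R/dR (via ψ(\overline{f\, dg}) = \overline{ψ(f)\, dψ(g)}) by: ψ_c^+(ω₀) = −ω₀; ψ_c^+(ω_i) = −c^{n+3−2i} ω_{n+3−i} for 1 ≤ i ≤ n+2; and ψ_c^+(ω_i) = −c^{n+3−2i} Σ_{m=1}^{2n} P_{i−n−3,−m}\, ω_m for n+3 ≤ i ≤ 2n. -/

import Mathlib

open scoped BigOperators

noncomputable section

/-- The hyperelliptic ring `R = ℂ[t,t⁻¹,u : u² = p(t)]`, realized as
`ℂ[t,t⁻¹][X]/(X² - p)`. -/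
abbrev HypRing (p : LaurentPolynomial ℂ) : Type :=
  AdjoinRoot (Polynomial.X ^ 2 - Polynomial.C p)

/-- The element `t^i` of `R`, for `i : ℤ`. -/
noncomputable def tP (p : LaurentPolynomial ℂ) (i : ℤ) : HypRing p :=
  AdjoinRoot.of _ (LaurentPolynomial.T i)

/-- The element `u` of `R`. -/
noncomputable def uE (p : LaurentPolynomial ℂ) : HypRing p := AdjoinRoot.root _

/-- The module of Kähler differentials `Ω_R` of `R` over `ℂ`. -/
abbrev HypOmega (p : LaurentPolynomial ℂ) := KaehlerDifferential ℂ (HypRing p)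

/-- The subspace `dR ⊆ Ω_R` of exact differentials. -/
noncomputable def dSub (p : LaurentPolynomial ℂ) : Submodule ℂ (HypOmega p) :=
  LinearMap.range (KaehlerDifferential.D ℂ (HypRing p)).toLinearMap

/-- The quotient `Ω_R/dR`. -/
abbrev HypCenter (p : LaurentPolynomial ℂ) := HypOmega p ⧸ dSub p

/-- The class `\overline{f dg}` of `f dg` in `Ω_R/dR`. -/
noncomputable def cls (p : LaurentPolynomial ℂ) (f g : HypRing p) : HypCenter p :=
  Submodule.Quotient.mk (f • (KaehlerDifferential.D ℂ (HypRing p) g))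

/-- `ω₀ = \overline{t⁻¹ dt}` and `ω_k = \overline{t^{-k} u dt}` for `k ≥ 1`. -/
noncomputable def om (p : LaurentPolynomial ℂ) (k : ℕ) : HypCenter p :=
  if k = 0 then cls p (tP p (-1)) (tP p 1)
  else cls p (tP p (-(k : ℤ)) * uE p) (tP p 1)

open Polynomial in
/-- The top coefficient of `t ∏ (t - αᵢ)`, read off from any expansion in powers of `t`, is `1`. -/
theorem coeff_top_eq_one {N : ℕ} (α : Fin N → ℂ) (a : ℕ → ℂ)
    (h : LaurentPolynomial.T 1 *
        ∏ i : Fin N, (LaurentPolynomial.T 1 - LaurentPolynomial.C (α i)) =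
      ∑ i ∈ Finset.Icc 1 (N + 1), LaurentPolynomial.C (a i) * LaurentPolynomial.T (i : ℤ)) :
    a (N + 1) = 1 := by
  have hpoly : (X * ∏ i : Fin N, (X - C (α i)) : ℂ[X]) =
      ∑ i ∈ Finset.Icc 1 (N + 1), C (a i) * X ^ i := by
    apply Polynomial.toLaurent_injective
    simpa [map_prod, map_sum] using h
  have hmonic : (∏ i : Fin N, (X - C (α i)) : ℂ[X]).Monic :=
    monic_prod_of_monic _ _ fun i _ => monic_X_sub_C (α i)
  have hdeg : (∏ i : Fin N, (X - C (α i)) : ℂ[X]).natDegree = N := by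
    simp
  have hcoeff := congrArg (fun q : ℂ[X] => q.coeff (N + 1)) hpoly
  simp only [coeff_X_mul, finsetSum_coeff, coeff_C_mul_X_pow] at hcoeff
  rw [Finset.sum_ite_eq, if_pos (by simp)] at hcoeff
  rw [← hcoeff]
  simpa [hdeg] using hmonic.coeff_natDegree

theorem derivation_zpow_of_add {A M : Type*} [CommRing A] [Algebra ℂ A] [AddCommGroup M]
    [Module ℂ M] [Module A M] (D : Derivation ℂ A M) (T : ℤ → A)
    (hT₀ : T 0 = 1) (hT : ∀ i j, T (i + j) = T i * T j) (k : ℤ) :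
    D (T k) = ((k : A) * T (k - 1)) • D (T 1) := by
  have step (k : ℤ) : D (T (k + 1)) = T k • D (T 1) + T 1 • D (T k) := by
    rw [hT, Derivation.leibniz]
  induction k with
  | zero => simp [hT₀]
  | succ i ih =>
    have h : T (i : ℤ) = T 1 * T (i - 1) := by rw [← hT]; congr 1; ring
    rw [step, ih, smul_smul, ← add_smul, add_sub_cancel_right, h]
    congr 1
    push_cast
    ring
  | pred i ih =>
    have h := step (-(i : ℤ) - 1)
    rw [sub_add_cancel, ih] at h
    have h' := congrArg (fun x => T (-1) • x) h
    have hinv : T (-1) * T 1 = 1 := by rw [← hT, neg_add_cancel, hT₀]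
    simp only [smul_add, smul_smul, hinv, one_smul] at h'
    rw [← sub_eq_iff_eq_add', ← sub_smul] at h'
    rw [← h', show (-(i : ℤ) - 1 - 1) = -1 + (-(i : ℤ) - 1) by ring, hT (-1)]
    congr 1
    push_cast
    ring

/-- Twice the differential of `t^s u³`, when `u² = ∑ aⱼ t^j`. -/
theorem two_smul_derivation_zpow_mul_cube {A M : Type*} [CommRing A] [Algebra ℂ A]
    [AddCommGroup M] [Module ℂ M] [Module A M] [IsScalarTower ℂ A M]
    (D : Derivation ℂ A M) (T : ℤ → A) (hT₀ : T 0 = 1) (hT : ∀ i j, T (i + j) = T i * T j)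
    (u : A) (S : Finset ℕ) (a : ℕ → ℂ) (hsq : u ^ 2 = ∑ j ∈ S, a j • T j) (s : ℤ) :
    (2 : A) • D (T s * u ^ 3) =
      (∑ j ∈ S, (((3 * (j : ℤ) + 2 * s : ℤ) : ℂ) * a j) • (T (s + j - 1) * u)) • D (T 1) := by
  have hD : (2 * u) • D u = (∑ j ∈ S, a j • ((j : A) * T (j - 1))) • D (T 1) := by
    have h := congrArg D hsq
    rw [pow_two, Derivation.leibniz, ← two_smul A, smul_smul, map_sum] at h
    rw [h, Finset.sum_smul]
    refine Finset.sum_congr rfl fun j _ => ?_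
    rw [Derivation.map_smul, derivation_zpow_of_add D T hT₀ hT, smul_assoc]
    simp
  have hcube : D (u ^ 3) = (3 * u ^ 2) • D u := by
    rw [Derivation.leibniz_pow, ← Nat.cast_smul_eq_nsmul A, smul_smul]
    simp
  have hcoeff : 3 * T s * u * (∑ j ∈ S, a j • ((j : A) * T (j - 1))) +
      2 * (u * ∑ j ∈ S, a j • T j) * (s * T (s - 1)) =
      ∑ j ∈ S, (((3 * (j : ℤ) + 2 * s : ℤ) : ℂ) * a j) • (T (s + j - 1) * u) := by
    simp only [Finset.mul_sum, Finset.sum_mul, ← Finset.sum_add_distrib]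
    refine Finset.sum_congr rfl fun j _ => ?_
    have h₁ : T (s + j - 1) = T s * T (j - 1) := by rw [← hT]; congr 1; ring
    have h₂ : T s * T (j - 1) = T j * T (s - 1) := by
      rw [← hT, ← hT]; congr 1; ring
    rw [h₁]
    simp only [Algebra.smul_def, map_mul, map_intCast]
    push_cast
    linear_combination (-2 * algebraMap ℂ A (a j) * (s : A) * u) * h₂
  rw [← hcoeff, ← hsq, add_smul, mul_smul (3 * T s * u), ← hD, Derivation.leibniz, hcube,
    derivation_zpow_of_add D T hT₀ hT s]
  simp only [smul_add, smul_smul]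
  congr 2 <;> ring

section HypRing

variable (p : LaurentPolynomial ℂ)

theorem tP_zero : tP p 0 = 1 := by simp [tP]

theorem tP_add (i j : ℤ) : tP p (i + j) = tP p i * tP p j := by
  rw [tP, LaurentPolynomial.T_add, map_mul]
  rfl

theorem tP_neg_one_pow (i : ℕ) : tP p (-1) ^ i = tP p (-(i : ℤ)) := by
  simp [tP, ← map_pow, LaurentPolynomial.T_pow]

theorem tP_one_pow (i : ℕ) : tP p 1 ^ i = tP p i := by
  simp [tP, ← map_pow, LaurentPolynomial.T_pow]

theorem uE_sq : uE p ^ 2 = AdjoinRoot.of (Polynomial.X ^ 2 - Polynomial.C p) p := by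
  have h := AdjoinRoot.eval₂_root (Polynomial.X ^ 2 - Polynomial.C p)
  rw [Polynomial.eval₂_sub, Polynomial.eval₂_pow, Polynomial.eval₂_X, Polynomial.eval₂_C,
    sub_eq_zero] at h
  exact h

theorem of_C_mul_T (b : ℂ) (i : ℤ) :
    AdjoinRoot.of (Polynomial.X ^ 2 - Polynomial.C p)
      (LaurentPolynomial.C b * LaurentPolynomial.T i) = b • tP p i := by
  rw [map_mul, Algebra.smul_def]
  rfl

theorem uE_sq_eq_sum (s : Finset ℕ) (a : ℕ → ℂ)
    (hpa : p = ∑ i ∈ s, LaurentPolynomial.C (a i) * LaurentPolynomial.T (i : ℤ)) :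
    uE p ^ 2 = ∑ i ∈ s, a i • tP p i := by
  rw [uE_sq]
  conv_lhs => rw [congrArg (AdjoinRoot.of (Polynomial.X ^ 2 - Polynomial.C p)) hpa]
  rw [map_sum]
  exact Finset.sum_congr rfl fun i _ => of_C_mul_T p (a i) i

/-- The linear map `f ↦ \overline{f dg}`. -/
def clsLinear (g : HypRing p) : HypRing p →ₗ[ℂ] HypCenter p :=
  (dSub p).mkQ ∘ₗ
    (LinearMap.toSpanSingleton (HypRing p) (HypOmega p)
      (KaehlerDifferential.D ℂ (HypRing p) g)).restrictScalars ℂ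

theorem clsLinear_apply (f g : HypRing p) : clsLinear p g f = cls p f g := rfl

theorem cls_smul_left (b : ℂ) (f g : HypRing p) : cls p (b • f) g = b • cls p f g :=
  (clsLinear p g).map_smul b f

theorem cls_smul_right (b : ℂ) (f g : HypRing p) : cls p f (b • g) = b • cls p f g := by
  rw [← cls_smul_left]
  simp only [cls, Derivation.map_smul]
  rw [smul_comm, smul_assoc]

theorem cls_tP_right (f : HypRing p) (k : ℤ) :
    cls p f (tP p k) = (k : ℂ) • cls p (f * tP p (k - 1)) (tP p 1) := by
  rw [← cls_smul_left]
  simp only [cls]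
  rw [derivation_zpow_of_add _ (tP p) (tP_zero p) (tP_add p), smul_smul]
  congr 2
  rw [Algebra.smul_def, map_intCast]
  ring

/-- Exactness of `d(t^s u³)` gives a linear relation between the classes of `t^j u dt`. -/
theorem sum_cls_tP_mul_uE_eq_zero (S : Finset ℕ) (a : ℕ → ℂ)
    (hpa : p = ∑ i ∈ S, LaurentPolynomial.C (a i) * LaurentPolynomial.T (i : ℤ)) (s : ℤ) :
    ∑ j ∈ S, (((3 * (j : ℤ) + 2 * s : ℤ) : ℂ) * a j) •
      cls p (tP p (s + j - 1) * uE p) (tP p 1) = 0 := by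
  have hexact := two_smul_derivation_zpow_mul_cube (KaehlerDifferential.D ℂ (HypRing p)) (tP p)
    (tP_zero p) (tP_add p) (uE p) S a (uE_sq_eq_sum p S a hpa) s
  have hcls : clsLinear p (tP p 1)
      (∑ j ∈ S, (((3 * (j : ℤ) + 2 * s : ℤ) : ℂ) * a j) • (tP p (s + j - 1) * uE p)) = 0 := by
    rw [clsLinear_apply, cls, ← hexact, Submodule.Quotient.mk_eq_zero]
    refine ⟨2 * (tP p s * uE p ^ 3), ?_⟩
    rw [two_mul, map_add, two_smul]
    rfl
  simpa only [map_sum, map_smul, clsLinear_apply] using hcls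

/-- The classes of `t^k u dt`, `k ≥ -2n`, are expressed through `ω₁, …, ω_{2n}` by any family of
coefficients satisfying the recursion attached to the coefficients of `p`. -/
theorem cls_tP_mul_uE_eq_sum (n : ℕ) (a : ℕ → ℂ)
    (hpa : p = ∑ i ∈ Finset.Icc 1 (2 * n + 1),
      LaurentPolynomial.C (a i) * LaurentPolynomial.T (i : ℤ))
    (htop : a (2 * n + 1) = 1) (P : ℤ → ℤ → ℂ)
    (hPinit : ∀ l i : ℤ, -(2 * n : ℤ) ≤ l → l ≤ -1 → -(2 * n : ℤ) ≤ i → i ≤ -1 →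
      P l i = if l = i then 1 else 0)
    (hPrec : ∀ k : ℤ, 0 ≤ k → ∀ i : ℤ,
      ((2 * k + 2 * (n : ℤ) + 3 : ℤ) : ℂ) * P k i
        = -∑ j ∈ Finset.Icc 1 (2 * n),
            ((3 * (j : ℤ) + 2 * k - 4 * (n : ℤ) : ℤ) : ℂ) * a j * P (k - 2 * n + j - 1) i)
    (k : ℤ) (hk : -(2 * n : ℤ) ≤ k) :
    cls p (tP p k * uE p) (tP p 1) =
      ∑ m ∈ Finset.Icc 1 (2 * n), P k (-(m : ℤ)) • om p m := by
  induction hN : (k + 2 * n).toNat using Nat.strong_induction_on generalizing k with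
  | _ N ih =>
    rcases lt_or_ge k 0 with hneg | hnonneg
    · obtain ⟨m, rfl⟩ : ∃ m : ℕ, k = -(m : ℤ) := ⟨(-k).toNat, by omega⟩
      rw [Finset.sum_eq_single_of_mem m (by rw [Finset.mem_Icc]; omega)]
      · rw [hPinit _ _ hk (by omega) hk (by omega), if_pos rfl, one_smul, om,
          if_neg (by omega)]
      · intro b hb hbm
        rw [Finset.mem_Icc] at hb
        rw [hPinit _ _ hk (by omega) (by omega) (by omega), if_neg (by omega), zero_smul]
    · have hrel := sum_cls_tP_mul_uE_eq_zero p _ a hpa (k - 2 * n)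
      rw [Finset.sum_Icc_succ_top (by omega), htop, mul_one] at hrel
      have hidx : k - 2 * n + ((2 * n + 1 : ℕ) : ℤ) - 1 = k := by push_cast; ring
      have hc : (3 * ((2 * n + 1 : ℕ) : ℤ) + 2 * (k - 2 * n)) = 2 * k + 2 * (n : ℤ) + 3 := by
        push_cast; ring
      rw [hidx, hc] at hrel
      have hne : ((2 * k + 2 * (n : ℤ) + 3 : ℤ) : ℂ) ≠ 0 := by
        rw [Int.cast_ne_zero]; omega
      refine smul_right_injective _ hne ?_
      simp only [Finset.smul_sum, smul_smul, hPrec k hnonneg]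
      rw [eq_neg_of_add_eq_zero_right hrel]
      simp only [neg_smul, Finset.sum_smul, Finset.sum_neg_distrib]
      rw [Finset.sum_comm]
      congr 1
      refine Finset.sum_congr rfl fun j hj => ?_
      rw [Finset.mem_Icc] at hj
      rw [ih _ (by omega) (k - 2 * n + j - 1) (by omega) rfl, Finset.smul_sum]
      refine Finset.sum_congr rfl fun m _ => ?_
      rw [smul_smul]
      congr 4
      ring

/-- An automorphism acting as `ψ_c^+` sends `\overline{t^{-i} u dt}` to
`-c^{n+3-2i} \overline{t^{i-n-3} u dt}`. -/
theorem cls_reflection (n : ℕ) (c : ℂ) (hc : c ≠ 0) (ψ : HypRing p ≃ₐ[ℂ] HypRing p)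
    (hψt : ψ (tP p 1) = c ^ 2 • tP p (-1))
    (hψinv : ψ (tP p (-1)) = (c ^ 2)⁻¹ • tP p 1)
    (hψu : ψ (uE p) = c ^ (n + 1) • (tP p (-(n : ℤ) - 1) * uE p)) (i : ℕ) :
    cls p (ψ (tP p (-(i : ℤ)) * uE p)) (ψ (tP p 1)) =
      (-(c ^ ((n : ℤ) + 3 - 2 * (i : ℤ)))) •
        cls p (tP p ((i : ℤ) - n - 3) * uE p) (tP p 1) := by
  have hf : ψ (tP p (-(i : ℤ)) * uE p) =
      ((c ^ 2)⁻¹ ^ i * c ^ (n + 1)) • (tP p i * (tP p (-(n : ℤ) - 1) * uE p)) := by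
    rw [map_mul, ← tP_neg_one_pow, map_pow, hψinv, hψu, smul_pow, tP_one_pow,
      smul_mul_smul_comm]
  have hshift : tP p i * (tP p (-(n : ℤ) - 1) * uE p) * tP p (-1 - 1) =
      tP p ((i : ℤ) - n - 3) * uE p := by
    rw [← mul_assoc, ← tP_add, mul_right_comm, ← tP_add]
    congr 2
    ring
  have hscal : (c ^ 2)⁻¹ ^ i * c ^ (n + 1) * (c ^ 2 * ((-1 : ℤ) : ℂ)) =
      -(c ^ ((n : ℤ) + 3 - 2 * (i : ℤ))) := by
    have h : c ^ ((n : ℤ) + 3 - 2 * (i : ℤ)) = c ^ (n + 3) * ((c ^ 2) ^ i)⁻¹ := by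
      rw [zpow_sub₀ hc, div_eq_mul_inv, zpow_mul, zpow_natCast]
      norm_cast
    rw [h, inv_pow]
    push_cast
    ring
  rw [hf, hψt, cls_smul_left, cls_smul_right, cls_tP_right, hshift, smul_smul, smul_smul,
    mul_assoc _ (c ^ 2), hscal]

theorem reflection_tP_neg_one (c : ℂ) (hc : c ≠ 0) (ψ : HypRing p ≃ₐ[ℂ] HypRing p)
    (hψt : ψ (tP p 1) = c ^ 2 • tP p (-1)) : ψ (tP p (-1)) = (c ^ 2)⁻¹ • tP p 1 := by
  have hinv : tP p (-1) * tP p 1 = 1 := by rw [← tP_add, neg_add_cancel, tP_zero]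
  have hψ : ψ (tP p (-1)) * (c ^ 2 • tP p (-1)) = 1 := by
    rw [← hψt, ← map_mul, hinv, map_one]
  refine left_inv_eq_right_inv hψ ?_
  rw [smul_mul_smul_comm, hinv, mul_inv_cancel₀ (pow_ne_zero 2 hc), one_smul]

end HypRing

/-- The automorphism `ψ_c^+` acts on `Ω_R/dR` by `ψ(\overline{f dg}) = \overline{ψ(f) dψ(g)}`,
with `ψ_c^+(ω₀) = −ω₀`, `ψ_c^+(ω_i) = −c^{n+3−2i} ω_{n+3−i}` for `1 ≤ i ≤ n+2`, and
`ψ_c^+(ω_i) = −c^{n+3−2i} Σ_{m=1}^{2n} P_{i−n−3,−m} ω_m` for `n+3 ≤ i ≤ 2n`. -/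
theorem reflection_action_on_center (n : ℕ) (hn : 1 ≤ n)
    (α : Fin (2 * n) → ℂ) (hα0 : ∀ i, α i ≠ 0) (hαinj : Function.Injective α)
    (a : ℕ → ℂ) (p : LaurentPolynomial ℂ)
    (hp : p = LaurentPolynomial.T 1 *
      ∏ i : Fin (2 * n), (LaurentPolynomial.T 1 - LaurentPolynomial.C (α i)))
    (hpa : p = ∑ i ∈ Finset.Icc 1 (2 * n + 1),
      LaurentPolynomial.C (a i) * LaurentPolynomial.T (i : ℤ))
    (c : ℂ) (hc : c ≠ 0)
    (β : Equiv.Perm (Fin (2 * n))) (hβ : ∀ i, α i * α (β i) = c ^ 2)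
    (ha1 : ∏ i : Fin (2 * n), α i = c ^ (2 * n))
    (P : ℤ → ℤ → ℂ)
    (hPinit : ∀ l i : ℤ, -(2 * n : ℤ) ≤ l → l ≤ -1 → -(2 * n : ℤ) ≤ i → i ≤ -1 →
      P l i = if l = i then 1 else 0)
    (hPrec : ∀ k : ℤ, 0 ≤ k → ∀ i : ℤ,
      ((2 * k + 2 * (n : ℤ) + 3 : ℤ) : ℂ) * P k i
        = -∑ j ∈ Finset.Icc 1 (2 * n),
            ((3 * (j : ℤ) + 2 * k - 4 * (n : ℤ) : ℤ) : ℂ) * a j * P (k - 2 * n + j - 1) i)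
    (ψp : HypRing p ≃ₐ[ℂ] HypRing p)
    (hψt : ψp (tP p 1) = c ^ 2 • tP p (-1))
    (hψu : ψp (uE p) = c ^ (n + 1) • (tP p (-(n : ℤ) - 1) * uE p)) :
    cls p (ψp (tP p (-1))) (ψp (tP p 1)) = -om p 0 ∧
    (∀ i : ℕ, 1 ≤ i → i ≤ n + 2 →
      cls p (ψp (tP p (-(i : ℤ)) * uE p)) (ψp (tP p 1))
        = (-(c ^ ((n : ℤ) + 3 - 2 * (i : ℤ)))) • om p (n + 3 - i)) ∧
    (∀ i : ℕ, n + 3 ≤ i → i ≤ 2 * n →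
      cls p (ψp (tP p (-(i : ℤ)) * uE p)) (ψp (tP p 1))
        = (-(c ^ ((n : ℤ) + 3 - 2 * (i : ℤ)))) •
            ∑ m ∈ Finset.Icc 1 (2 * n), P ((i : ℤ) - n - 3) (-(m : ℤ)) • om p m) := by
  have hψinv := reflection_tP_neg_one p c hc ψp hψt
  have hψ := cls_reflection p n c hc ψp hψt hψinv hψu
  have htop : a (2 * n + 1) = 1 := coeff_top_eq_one α a (hp.symm.trans hpa)
  refine ⟨?_, fun i hi₁ hi₂ => ?_, fun i hi₁ hi₂ => ?_⟩
  · rw [hψinv, hψt, cls_smul_left, cls_smul_right, cls_tP_right, smul_smul,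
      inv_mul_cancel₀ (pow_ne_zero 2 hc), one_smul, ← tP_add, om, if_pos rfl]
    norm_num
  · rw [hψ, om, if_neg (by omega)]
    congr 4
    omega
  · rw [hψ, cls_tP_mul_uE_eq_sum p n a hpa htop P hPinit hPrec _ (by omega)]

end
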